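/- Let k ≥ 1 and let a_0, a_1, …, a_k be positive integers with a_0 ≥ 2 and a_j ≥ 2 for some fixed j with 1 ≤ j ≤ k. Then K(a_0,{a_1,…,a_k}) ≺_s K(a_0+a_j−1,{a_1,…,a_{j−1},1,a_{j+1},…,a_k}); indeed both graphs have n = a_0+a_1+…+a_k vertices and no triangles lost in S_0 and S_1, while the second graph has exactly (a_j−1)(a_0−1) more edges than the first, so S_0 and S_1 agree and S_2 is strictly larger for the second graph. -/

import Mathlib

open SimpleGraph

/-- The `k`-th spectral moment of a graph: the trace of the `k`-th power of its
adjacency matrix. -/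
noncomputable def specMoment {V : Type*} [Fintype V] (G : SimpleGraph V) (k : ℕ) : ℝ :=
  letI := Classical.decEq V
  letI : DecidableRel G.Adj := Classical.decRel _
  Matrix.trace ((G.adjMatrix ℝ) ^ k)

/-- The strict lexicographic order by spectral moments (`S`-order) for graphs on
`n` vertices. -/
def SLt {V W : Type*} [Fintype V] [Fintype W] (n : ℕ)
    (G : SimpleGraph V) (H : SimpleGraph W) : Prop :=
  ∃ k, 1 ≤ k ∧ k ≤ n - 1 ∧ (∀ i, i < k → specMoment G i = specMoment H i) ∧
    specMoment G k < specMoment H k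

/-- `Kclique k a` is the graph `K(a 0, {a 1, …, a k})`: it is obtained from the
star `K_{1,k}` with center `u_0` and leaves `u_1, …, u_k` by replacing each
vertex `u_i` by a clique on `a i` vertices; for each star edge `u_0 u_i`
(`i ≠ 0`) the designated vertex `⟨i, 0⟩` of the `i`-th clique is joined to the
designated vertex `⟨0, 0⟩` of the central clique. -/
def Kclique (k : ℕ) (a : Fin (k + 1) → ℕ) :
    SimpleGraph ((i : Fin (k + 1)) × Fin (a i)) :=
  SimpleGraph.fromRel (fun p q =>
    p.1 = q.1 ∨ (p.1 = 0 ∧ (p.2 : ℕ) = 0 ∧ (q.2 : ℕ) = 0))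

open Classical in
/-- Number of ordered adjacent pairs. -/
noncomputable def pairCount {V : Type*} [Fintype V] (G : SimpleGraph V) : ℕ :=
  ∑ p : V, ∑ q : V, if G.Adj p q then 1 else 0

theorem specMoment_zero' {V : Type*} [Fintype V] (G : SimpleGraph V) :
    specMoment G 0 = Fintype.card V := by
  classical
  simp [specMoment]

theorem specMoment_one' {V : Type*} [Fintype V] (G : SimpleGraph V) :
    specMoment G 1 = 0 := by
  classical
  simp [specMoment]

theorem specMoment_two' {V : Type*} [Fintype V] (G : SimpleGraph V) :
    specMoment G 2 = pairCount G := by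
  classical
  simp only [specMoment, pairCount, pow_two, Matrix.trace, Matrix.diag_apply, Matrix.mul_apply,
    SimpleGraph.adjMatrix_apply]
  push_cast
  refine Finset.sum_congr rfl fun p _ => Finset.sum_congr rfl fun q _ => ?_
  by_cases h : G.Adj p q
  · simp [h, h.symm]
  · simp [h]

theorem pairCount_eq {V : Type*} [Fintype V] (G : SimpleGraph V) :
    pairCount G = 2 * G.edgeSet.ncard := by
  classical
  rw [Set.ncard_eq_toFinset_card', ← SimpleGraph.edgeFinset,
    ← SimpleGraph.sum_degrees_eq_twice_card_edges]
  refine Finset.sum_congr rfl fun p _ => ?_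
  rw [← SimpleGraph.card_neighborFinset_eq_degree, SimpleGraph.neighborFinset_eq_filter,
    Finset.card_filter]

theorem block_diag (m : ℕ) :
    (∑ x : Fin m, ∑ y : Fin m, if x ≠ y then 1 else 0) = m * (m - 1) := by
  have h : ∀ x : Fin m, (∑ y : Fin m, if x ≠ y then 1 else 0) = m - 1 := by
    intro x
    rw [← Finset.card_filter, Finset.filter_ne, Finset.card_erase_of_mem (Finset.mem_univ _)]
    simp
  simp only [h]
  simp

theorem block_off (m l : ℕ) (hm : 1 ≤ m) (hl : 1 ≤ l) :
    (∑ x : Fin m, ∑ y : Fin l, if (x : ℕ) = 0 ∧ (y : ℕ) = 0 then 1 else 0) = 1 := by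
  obtain ⟨m, rfl⟩ := Nat.exists_eq_add_of_le' hm
  obtain ⟨l, rfl⟩ := Nat.exists_eq_add_of_le' hl
  rw [Fin.sum_univ_succ, Fin.sum_univ_succ]
  simp [-Fin.val_eq_zero_iff]

theorem Kclique_adj_same (k : ℕ) (a : Fin (k + 1) → ℕ) (i : Fin (k + 1)) (x y : Fin (a i)) :
    (Kclique k a).Adj ⟨i, x⟩ ⟨i, y⟩ ↔ x ≠ y := by
  simp [Kclique]

theorem Kclique_adj_off (k : ℕ) (a : Fin (k + 1) → ℕ) (i l : Fin (k + 1)) (h : i ≠ l)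
    (x : Fin (a i)) (y : Fin (a l)) :
    (Kclique k a).Adj ⟨i, x⟩ ⟨l, y⟩ ↔ (i = 0 ∨ l = 0) ∧ ((x : ℕ) = 0 ∧ (y : ℕ) = 0) := by
  simp only [Kclique, SimpleGraph.fromRel_adj, ne_eq, Sigma.mk.injEq, h, h.symm, false_and,
    not_false_eq_true, true_and, false_or]
  tauto

theorem pairCount_Kclique (k : ℕ) (a : Fin (k + 1) → ℕ) (ha : ∀ i, 1 ≤ a i) :
    pairCount (Kclique k a) = ∑ i, a i * (a i - 1) +
      ∑ i : Fin (k + 1), ∑ l : Fin (k + 1), if i ≠ l ∧ (i = 0 ∨ l = 0) then 1 else 0 := by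
  classical
  have key : ∀ i l : Fin (k + 1),
      (∑ x : Fin (a i), ∑ y : Fin (a l), if (Kclique k a).Adj ⟨i, x⟩ ⟨l, y⟩ then 1 else 0)
      = (if i = l then a i * (a i - 1) else 0) +
        if i ≠ l ∧ (i = 0 ∨ l = 0) then 1 else 0 := by
    intro i l
    by_cases h : i = l
    · subst h
      simp only [Kclique_adj_same, block_diag]
      simp
    · simp only [Kclique_adj_off k a i l h]
      by_cases h0 : i = 0 ∨ l = 0
      · simp only [h0, true_and, block_off _ _ (ha i) (ha l)]
        simp [h]
      · simp [h0, h]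
  unfold pairCount
  rw [Fintype.sum_sigma]
  simp only [Fintype.sum_sigma]
  have : ∀ i : Fin (k + 1), (∑ x : Fin (a i), ∑ l : Fin (k + 1), ∑ y : Fin (a l),
      if (Kclique k a).Adj ⟨i, x⟩ ⟨l, y⟩ then 1 else 0) = a i * (a i - 1) +
      ∑ l : Fin (k + 1), if i ≠ l ∧ (i = 0 ∨ l = 0) then 1 else 0 := by
    intro i
    rw [Finset.sum_comm]
    simp only [key, Finset.sum_add_distrib]
    simp
  rw [Finset.sum_congr rfl fun i _ => this i, Finset.sum_add_distrib]

theorem sum_move (k : ℕ) (a : Fin (k + 1) → ℕ) (j : Fin (k + 1)) (hj : j ≠ 0) (c d : ℕ)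
    (f : ℕ → ℕ) :
    (∑ i, f (Function.update (Function.update a j d) 0 c i)) + f (a 0) + f (a j)
      = (∑ i, f (a i)) + f c + f d := by
  have hm : j ∈ Finset.univ.erase (0 : Fin (k + 1)) := by simp [hj]
  have e : ∀ g : Fin (k + 1) → ℕ,
      ∑ i, g i = g 0 + (g j + ∑ i ∈ (Finset.univ.erase 0).erase j, g i) := by
    intro g
    rw [Finset.add_sum_erase _ _ hm, Finset.add_sum_erase _ _ (Finset.mem_univ _)]
  rw [e, e (fun i => f (a i))]
  have r : ∑ i ∈ (Finset.univ.erase 0).erase j,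
      f (Function.update (Function.update a j d) 0 c i)
      = ∑ i ∈ (Finset.univ.erase 0).erase j, f (a i) := by
    refine Finset.sum_congr rfl fun i hi => ?_
    simp only [Finset.mem_erase] at hi
    simp [Function.update_of_ne, hi.1, hi.2.1]
  rw [r]
  simp [Function.update_of_ne hj]
  ring

/-- For `k ≥ 1` and positive integers `a 0 ≥ 2`, `a j ≥ 2` (with `j ≠ 0`),
the graph `K(a_0, {a_1, …, a_k})` comes strictly before
`K(a_0 + a_j - 1, {a_1, …, a_{j-1}, 1, a_{j+1}, …, a_k})` in the `S`-order:
both graphs have `n = a_0 + a_1 + … + a_k` vertices (so `S_0` agrees) and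
`S_1` agrees, while the second graph has exactly `(a_j - 1) * (a_0 - 1)` more
edges than the first, so its `S_2` is strictly larger. -/
theorem Kclique_move_S_lt (k : ℕ) (hk : 1 ≤ k) (a : Fin (k + 1) → ℕ)
    (ha : ∀ i, 1 ≤ a i) (ha0 : 2 ≤ a 0) (j : Fin (k + 1)) (hj : j ≠ 0)
    (haj : 2 ≤ a j) (n : ℕ) (hn : n = ∑ i, a i)
    (a' : Fin (k + 1) → ℕ)
    (ha' : a' = Function.update (Function.update a j 1) 0 (a 0 + a j - 1)) :
    Fintype.card ((i : Fin (k + 1)) × Fin (a i)) = n ∧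
    Fintype.card ((i : Fin (k + 1)) × Fin (a' i)) = n ∧
    specMoment (Kclique k a) 0 = specMoment (Kclique k a') 0 ∧
    specMoment (Kclique k a) 1 = specMoment (Kclique k a') 1 ∧
    (Kclique k a').edgeSet.ncard =
      (Kclique k a).edgeSet.ncard + (a j - 1) * (a 0 - 1) ∧
    SLt n (Kclique k a) (Kclique k a') := by
  have e1 := sum_move k a j hj (a 0 + a j - 1) 1 id
  have e2 := sum_move k a j hj (a 0 + a j - 1) 1 (fun m => m * (m - 1))
  rw [← ha'] at e1 e2
  have hpos : ∀ i, 1 ≤ a' i := by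
    intro i
    rw [ha']
    by_cases h0 : i = 0
    · subst h0
      simp
      omega
    · by_cases h1 : i = j
      · subst h1
        simp [h0]
      · simp [h0, h1, ha i]
  have p1 := pairCount_Kclique k a ha
  have p2 := pairCount_Kclique k a' hpos
  have c1 : Fintype.card ((i : Fin (k + 1)) × Fin (a i)) = n := by simp [hn]
  have c2 : Fintype.card ((i : Fin (k + 1)) × Fin (a' i)) = n := by
    simp only [id] at e1
    simp only [Fintype.card_sigma, Fintype.card_fin]
    omega
  have hE : pairCount (Kclique k a') =
      pairCount (Kclique k a) + 2 * ((a j - 1) * (a 0 - 1)) := by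
    rw [p1, p2]
    obtain ⟨u, hu⟩ := Nat.exists_eq_add_of_le' ha0
    obtain ⟨v, hv⟩ := Nat.exists_eq_add_of_le' haj
    have t1 : u + 2 + (v + 2) - 1 = u + v + 3 := by omega
    have t2 : u + v + 3 - 1 = u + v + 2 := by omega
    have t3 : u + 2 - 1 = u + 1 := by omega
    have t4 : v + 2 - 1 = v + 1 := by omega
    simp only [hu, hv, t1, t2, t3, t4] at e2 ⊢
    rw [Nat.sub_self, Nat.mul_zero] at e2
    generalize (∑ i, a i * (a i - 1)) = X at e2 ⊢
    generalize (∑ i, a' i * (a' i - 1)) = Y at e2 ⊢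
    nlinarith [e2]
  have s0 : specMoment (Kclique k a) 0 = specMoment (Kclique k a') 0 := by
    rw [specMoment_zero', specMoment_zero', c1, c2]
  have s1 : specMoment (Kclique k a) 1 = specMoment (Kclique k a') 1 := by
    rw [specMoment_one', specMoment_one']
  have hprod : 0 < (a j - 1) * (a 0 - 1) := Nat.mul_pos (by omega) (by omega)
  refine ⟨c1, c2, s0, s1, ?_, 2, by norm_num, ?_, ?_, ?_⟩
  · rw [pairCount_eq, pairCount_eq] at hE
    omega
  · have h2 : ∑ i ∈ ({0, j} : Finset (Fin (k + 1))), a i ≤ ∑ i, a i :=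
      Finset.sum_le_sum_of_subset (Finset.subset_univ _)
    rw [Finset.sum_pair hj.symm] at h2
    omega
  · intro i hi
    interval_cases i
    · exact s0
    · exact s1
  · rw [specMoment_two', specMoment_two']
    have : pairCount (Kclique k a) < pairCount (Kclique k a') := by omega
    exact_mod_cast this
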